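/- (Abstract form of Theorem 1.7: log-Sobolev implies Gaussian concentration.) Let (X, d) be a metric space equipped with a Borel probability measure ν and let c > 0. Assume that for every bounded function F : X → ℝ which is 1-Lipschitz (LipschitzWith 1) and satisfies ∫ F dν = 0, and for every λ > 0, the entropy inequality ∫ λF·e^{λF} dν - (∫ e^{λF} dν)·log(∫ e^{λF} dν) ≤ c·λ²·∫ e^{λF} dν holds. Then for all nonempty Borel sets A, B ⊆ X one has the Gaussian concentration inequality ν(A)·ν(B) ≤ exp( - dist(A,B)²/(8c) ), where dist(A,B) = inf{ d(a,b) : a ∈ A, b ∈ B }. -/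

import Mathlib

open MeasureTheory Real

/-- The set distance `dist(A,B) = inf { dist a b : a ∈ A, b ∈ B }`
(not the Hausdorff distance). -/
noncomputable def setDist {X : Type*} [MetricSpace X] (A B : Set X) : ℝ :=
  sInf {d : ℝ | ∃ a ∈ A, ∃ b ∈ B, d = dist a b}

open Set Filter Topology ProbabilityTheory Metric

/-- Herbst's differential inequality: if `K 0 = K' 0 = 0` and `l K' l - K l ≤ c l²` for `l > 0`,
then `K l ≤ c l²` for `l ≥ 0`. -/
lemma le_mul_sq_of_mul_deriv_sub_le {K : ℝ → ℝ} {c : ℝ} (hK : Differentiable ℝ K)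
    (hK0 : K 0 = 0) (hK0' : deriv K 0 = 0)
    (h : ∀ l, 0 < l → l * deriv K l - K l ≤ c * l ^ 2) {l : ℝ} (hl : 0 ≤ l) :
    K l ≤ c * l ^ 2 := by
  rcases hl.eq_or_lt with rfl | hl
  · simp [hK0]
  have hd : ∀ t, 0 < t →
      HasDerivAt (fun t => K t / t - c * t) ((deriv K t * t - K t * 1) / t ^ 2 - c * 1) t :=
    fun t ht => ((hK t).hasDerivAt.div (hasDerivAt_id t) ht.ne').sub
      ((hasDerivAt_id t).const_mul c)
  have hanti : AntitoneOn (fun t => K t / t - c * t) (Ioi 0) := by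
    refine antitoneOn_of_deriv_nonpos (convex_Ioi 0)
      (fun t ht => (hd t ht).continuousAt.continuousWithinAt) ?_ ?_
    · rw [interior_Ioi]
      exact fun t ht => (hd t ht).differentiableAt.differentiableWithinAt
    · rw [interior_Ioi]
      intro t ht
      rw [(hd t ht).deriv, sub_nonpos, div_le_iff₀ (pow_pos ht 2)]
      linarith [h t ht]
  have hlim : Tendsto (fun t => K t / t - c * t) (𝓝[>] 0) (𝓝 0) := by
    have h1 := (hK 0).hasDerivAt.tendsto_slope_zero_right
    have h2 : Tendsto (fun t : ℝ => c * t) (𝓝[>] 0) (𝓝 (c * 0)) :=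
      ((continuous_const.mul continuous_id).tendsto 0).mono_left nhdsWithin_le_nhds
    simpa [hK0, hK0', div_eq_inv_mul] using h1.sub h2
  have hle : K l / l - c * l ≤ 0 := by
    refine ge_of_tendsto hlim ?_
    filter_upwards [Ioc_mem_nhdsGT hl] with t ht
    exact hanti ht.1 hl ht.2
  rw [sub_nonpos, div_le_iff₀ hl] at hle
  linarith

/-- The Herbst argument: an entropy inequality for the exponentials of a bounded centred random
variable bounds its cumulant generating function. -/
lemma cgf_le_of_entropy_le {Ω : Type*} [MeasurableSpace Ω] {μ : Measure Ω}
    [IsProbabilityMeasure μ] {F : Ω → ℝ} {c : ℝ}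
    (hint : ∀ t, Integrable (fun x => exp (t * F x)) μ) (hF0 : ∫ x, F x ∂μ = 0)
    (hent : ∀ l : ℝ, 0 < l →
      ∫ x, l * F x * exp (l * F x) ∂μ -
        (∫ x, exp (l * F x) ∂μ) * log (∫ x, exp (l * F x) ∂μ) ≤
        c * l ^ 2 * ∫ x, exp (l * F x) ∂μ) {l : ℝ} (hl : 0 ≤ l) :
    cgf F μ l ≤ c * l ^ 2 := by
  have hmem : ∀ t, t ∈ interior (integrableExpSet F μ) := by simp [hint, integrableExpSet]
  refine le_mul_sq_of_mul_deriv_sub_le (fun t => (analyticAt_cgf (hmem t)).differentiableAt)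
    cgf_zero (by simp [deriv_cgf_zero (hmem 0), hF0]) (fun t ht => ?_) hl
  have hpos : 0 < mgf F μ t := mgf_pos (hint t)
  have h := hent t ht
  simp_rw [mul_assoc t, integral_const_mul] at h
  change _ - mgf F μ t * cgf F μ t ≤ c * t ^ 2 * mgf F μ t at h
  rw [deriv_cgf (hmem t), mul_div_assoc', sub_le_iff_le_add, div_le_iff₀ hpos]
  linarith

lemma setDist_nonneg {X : Type*} [MetricSpace X] (A B : Set X) : 0 ≤ setDist A B := by
  refine Real.sInf_nonneg ?_
  rintro d ⟨a, -, b, -, rfl⟩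
  exact dist_nonneg

lemma setDist_le_dist {X : Type*} [MetricSpace X] {A B : Set X} {a b : X} (ha : a ∈ A)
    (hb : b ∈ B) : setDist A B ≤ dist a b := by
  refine csInf_le ⟨0, ?_⟩ ⟨a, ha, b, hb, rfl⟩
  rintro d ⟨a, -, b, -, rfl⟩
  exact dist_nonneg

/-- Abstract form of Theorem 1.7 of Hein–Naber: the entropy inequality obtained from a
log-Sobolev inequality with constant `4c`, tested on `φ² = e^{λF}/∫ e^{λF} dν` for
bounded 1-Lipschitz mean-zero `F`, implies Gaussian concentration. -/
theorem logSobolev_implies_gaussian_concentration {X : Type*} [MetricSpace X]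
    [MeasurableSpace X] [BorelSpace X] (ν : Measure X) [IsProbabilityMeasure ν]
    (c : ℝ) (hc : 0 < c)
    (hent : ∀ F : X → ℝ, (∃ M : ℝ, ∀ x, |F x| ≤ M) → LipschitzWith 1 F →
      (∫ x, F x ∂ν = 0) → ∀ l : ℝ, 0 < l →
      ∫ x, l * F x * Real.exp (l * F x) ∂ν -
        (∫ x, Real.exp (l * F x) ∂ν) * Real.log (∫ x, Real.exp (l * F x) ∂ν) ≤
        c * l ^ 2 * ∫ x, Real.exp (l * F x) ∂ν)
    (A B : Set X) (hA : MeasurableSet A) (hB : MeasurableSet B)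
    (hAne : A.Nonempty) (hBne : B.Nonempty) :
    ν A * ν B ≤ ENNReal.ofReal (Real.exp (-(setDist A B) ^ 2 / (8 * c))) := by
  set D := setDist A B
  have hD0 : 0 ≤ D := setDist_nonneg A B
  set f : X → ℝ := fun x => min (infDist x B) D
  have hfL : LipschitzWith 1 f := (lipschitz_infDist_pt B).min_const D
  have hf0 : ∀ x, 0 ≤ f x := fun x => le_min infDist_nonneg hD0
  have hfD : ∀ x, f x ≤ D := fun x => min_le_right _ _
  have hfA : ∀ x ∈ A, f x = D := fun x hx =>
    min_eq_right ((le_infDist hBne).2 fun y hy => setDist_le_dist hx hy)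
  have hfB : ∀ x ∈ B, f x = 0 := fun x hx => by
    simp [f, infDist_zero_of_mem hx, hD0]
  have hfint : Integrable f ν :=
    Integrable.of_mem_Icc 0 D hfL.continuous.measurable.aemeasurable
      (ae_of_all _ fun x => ⟨hf0 x, hfD x⟩)
  set m := ∫ x, f x ∂ν
  set l := D / (4 * c) with hl
  have hl0 : 0 ≤ l := by positivity
  have tail : ∀ F : X → ℝ, (∃ M : ℝ, ∀ x, |F x| ≤ M) → LipschitzWith 1 F →
      ∫ x, F x ∂ν = 0 → ∀ (S : Set X) (r : ℝ), (∀ x ∈ S, r ≤ F x) →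
      ν.real S ≤ exp (-l * r + c * l ^ 2) := by
    intro F ⟨M, hM⟩ hFL hF0 S r hS
    have hint : ∀ t, Integrable (fun x => exp (t * F x)) ν := fun t =>
      integrable_exp_mul_of_mem_Icc hFL.continuous.measurable.aemeasurable
        (ae_of_all _ fun x => abs_le.1 (hM x))
    calc ν.real S ≤ ν.real {x | r ≤ F x} := measureReal_mono hS
      _ ≤ exp (-l * r + cgf F ν l) := measure_ge_le_exp_cgf r hl0 (hint l)
      _ ≤ exp (-l * r + c * l ^ 2) := by
        gcongr
        exact cgf_le_of_entropy_le hint hF0 (hent F ⟨M, hM⟩ hFL hF0) hl0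
  have hbound : ∀ x, |f x - m| ≤ D + |m| := fun x =>
    (abs_sub _ _).trans (by rw [abs_of_nonneg (hf0 x)]; linarith [hfD x])
  have hLip : LipschitzWith 1 fun x => f x - m := by
    simpa using hfL.sub (LipschitzWith.const m)
  have hmean : ∫ x, (f x - m) ∂ν = 0 := by
    rw [integral_sub hfint (integrable_const m)]; simp [m]
  have hνA := tail (fun x => f x - m) ⟨_, hbound⟩ hLip hmean A (D - m)
    fun x hx => by rw [hfA x hx]
  have hνB := tail (fun x => -(f x - m)) ⟨D + |m|, fun x => by rw [abs_neg]; exact hbound x⟩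
    hLip.neg (by rw [integral_neg, hmean, neg_zero]) B m fun x hx => by rw [hfB x hx]; simp
  rw [← ofReal_measureReal (μ := ν) (s := A), ← ofReal_measureReal (μ := ν) (s := B),
    ← ENNReal.ofReal_mul measureReal_nonneg]
  refine ENNReal.ofReal_le_ofReal ?_
  calc ν.real A * ν.real B
      ≤ exp (-l * (D - m) + c * l ^ 2) * exp (-l * m + c * l ^ 2) := by gcongr
    _ = exp (-D ^ 2 / (8 * c)) := by
      rw [← exp_add, hl]
      congr 1
      field_simp
      ring
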